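/- (Sawyer's two-weight theorem for the dyadic maximal function.) Let 1<p<∞, let w and σ be two weights on ℝ^d (not assumed related), let 𝒟 be the standard dyadic grid, and let M_𝒟 denote the dyadic maximal operator. Let C₁ be the least constant in ‖M_𝒟(σf)‖_{L^p(w)} ≤ C₁‖f‖_{L^p(σ)} over all f ∈ L^p(σ), and C₂ the least constant in the testing inequality ∫_I M_𝒟(σχ_I)^p w dx ≤ C₂^p σ(I) over all I ∈ 𝒟. Then C₁ and C₂ are comparable: c(p,d)·C₂ ≤ C₁ ≤ C(p,d)·C₂; in particular the two-weight norm inequality holds if and only if the testing condition holds. -/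

import Mathlib

open MeasureTheory Set ENNReal

noncomputable section

/-- An axis-parallel cube in `ℝ^d` with corner `x` and side length `h`. -/
def cube (d : ℕ) (x : Fin d → ℝ) (h : ℝ) : Set (Fin d → ℝ) :=
  Set.univ.pi fun i => Set.Ico (x i) (x i + h)

/-- The average of (the nonnegative part of) `w` over a set `I`, valued in `ℝ≥0∞`. -/
def lavg (d : ℕ) (w : (Fin d → ℝ) → ℝ) (I : Set (Fin d → ℝ)) : ℝ≥0∞ :=
  (volume I)⁻¹ * ∫⁻ y in I, ENNReal.ofReal (w y)

/-- The `A_p` characteristic of a weight `w` on `ℝ^d`: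
the supremum over all cubes `I` of `(|I|⁻¹∫_I w)·(|I|⁻¹∫_I w^{-1/(p-1)})^{p-1}`. -/
def ApChar (d : ℕ) (p : ℝ) (w : (Fin d → ℝ) → ℝ) : ℝ≥0∞ :=
  ⨆ (x : Fin d → ℝ) (h : Set.Ioi (0:ℝ)),
    lavg d w (cube d x h) *
      (lavg d (fun y => w y ^ (-1 / (p - 1))) (cube d x h)) ^ (p - 1)

/-- A weight on `ℝ^d`: a measurable, locally integrable, a.e. positive function. -/
def IsWeight (d : ℕ) (w : (Fin d → ℝ) → ℝ) : Prop :=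
  Measurable w ∧ LocallyIntegrable w volume ∧ ∀ᵐ x : Fin d → ℝ, 0 < w x

/-- The standard dyadic cube `2^{-k}(n + [0,1)^d)` in `ℝ^d`. -/
def dyadicCube (d : ℕ) (k : ℤ) (n : Fin d → ℤ) : Set (Fin d → ℝ) :=
  Set.univ.pi fun i => Set.Ico ((n i : ℝ) * (2:ℝ) ^ (-k)) (((n i : ℝ) + 1) * (2:ℝ) ^ (-k))

/-- The dyadic maximal operator `M_𝒟 g(x) := sup_{I∈𝒟, x∈I} |I|⁻¹ ∫_I |g|`. -/
def dyadicMax (d : ℕ) (g : (Fin d → ℝ) → ℝ) (x : Fin d → ℝ) : ℝ≥0∞ :=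
  ⨆ (k : ℤ) (n : Fin d → ℤ) (_ : x ∈ dyadicCube d k n),
    (volume (dyadicCube d k n))⁻¹ * ∫⁻ y in dyadicCube d k n, (‖g y‖₊ : ℝ≥0∞)

/-- The least constant `C₁` in the two-weight norm inequality
`‖M_𝒟(σf)‖_{L^p(w)} ≤ C₁ ‖f‖_{L^p(σ)}`. -/
def sawyerNormConst (d : ℕ) (p : ℝ) (w σ : (Fin d → ℝ) → ℝ) : ℝ≥0∞ :=
  sInf {c : ℝ≥0∞ | ∀ f : (Fin d → ℝ) → ℝ, Measurable f →
    (∫⁻ x, (dyadicMax d (fun y => σ y * f y) x) ^ p * ENNReal.ofReal (w x)) ^ (1 / p) ≤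
      c * (∫⁻ x, (‖f x‖₊ : ℝ≥0∞) ^ p * ENNReal.ofReal (σ x)) ^ (1 / p)}

/-- The least constant `C₂` in the testing inequality
`∫_I M_𝒟(σχ_I)^p w dx ≤ C₂^p σ(I)` over all dyadic cubes `I`. -/
def sawyerTestConst (d : ℕ) (p : ℝ) (w σ : (Fin d → ℝ) → ℝ) : ℝ≥0∞ :=
  sInf {c : ℝ≥0∞ | ∀ (k : ℤ) (n : Fin d → ℤ),
    ∫⁻ x in dyadicCube d k n,
        (dyadicMax d ((dyadicCube d k n).indicator σ) x) ^ p * ENNReal.ofReal (w x) ≤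
      c ^ p * ∫⁻ y in dyadicCube d k n, ENNReal.ofReal (σ y)}

/-- A finite subfamily of a nested family of sets has a pairwise disjoint subfamily
of maximal members. -/
lemma exists_pairwiseDisjoint_maximal {X ι : Type*} (Q : ι → Set X)
    (hQ : ∀ i j, Disjoint (Q i) (Q j) ∨ Q i ⊆ Q j ∨ Q j ⊆ Q i) (G : Finset ι) :
    ∃ H ⊆ G, (H : Set ι).PairwiseDisjoint Q ∧ ∀ i ∈ G, ∃ j ∈ H, Q i ⊆ Q j := by
  classical
  induction G using Finset.induction_on with
  | empty => exact ⟨∅, subset_rfl, by simp, by simp⟩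
  | insert a G _ ih =>
    obtain ⟨H, hHG, hd, hcov⟩ := ih
    by_cases h : ∃ j ∈ H, Q a ⊆ Q j
    · refine ⟨H, hHG.trans (Finset.subset_insert _ _), hd, fun i hi => ?_⟩
      rcases Finset.mem_insert.1 hi with rfl | hi
      exacts [h, hcov i hi]
    · push Not at h
      refine ⟨insert a (H.filter fun j => ¬ Q j ⊆ Q a), ?_, ?_, ?_⟩
      · exact Finset.insert_subset_insert _ ((Finset.filter_subset _ _).trans hHG)
      · rw [Finset.coe_insert]
        refine Set.PairwiseDisjoint.insert (hd.subset ?_) ?_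
        · exact_mod_cast Finset.filter_subset _ _
        · intro j hj _
          have hj' := Finset.mem_filter.1 (Finset.mem_coe.1 hj)
          rcases hQ a j with h1 | h1 | h1
          exacts [h1, absurd h1 (h j hj'.1), absurd h1 hj'.2]
      · intro i hi
        rcases Finset.mem_insert.1 hi with rfl | hi
        · exact ⟨i, Finset.mem_insert_self _ _, subset_rfl⟩
        · obtain ⟨j, hj, hij⟩ := hcov i hi
          by_cases hja : Q j ⊆ Q a
          · exact ⟨a, Finset.mem_insert_self _ _, hij.trans hja⟩
          · exact ⟨j, Finset.mem_insert_of_mem (Finset.mem_filter.2 ⟨hj, hja⟩), hij⟩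

lemma lintegral_Ioi_indicator_rpow_ofReal {q : ℝ} (hq : 0 < q) {r : ℝ} (hr : 0 ≤ r) :
    ∫⁻ t in Ioi (0 : ℝ), {t : ℝ | ENNReal.ofReal t < ENNReal.ofReal r}.indicator
      (fun t => ENNReal.ofReal t ^ (q - 1)) t = ENNReal.ofReal r ^ q / ENNReal.ofReal q := by
  have hm : MeasurableSet {t : ℝ | ENNReal.ofReal t < ENNReal.ofReal r} :=
    measurableSet_lt ENNReal.measurable_ofReal measurable_const
  have hset : {t : ℝ | ENNReal.ofReal t < ENNReal.ofReal r} ∩ Ioi 0 = Ioo 0 r := by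
    ext t
    simp only [mem_inter_iff, mem_ofPred_eq, mem_Ioi, mem_Ioo]
    constructor
    · rintro ⟨h, h0⟩
      exact ⟨h0, (ENNReal.ofReal_lt_ofReal_iff'.1 h).1⟩
    · rintro ⟨h0, h⟩
      exact ⟨ENNReal.ofReal_lt_ofReal_iff'.2 ⟨h, h0.trans h⟩, h0⟩
  rw [lintegral_indicator hm, Measure.restrict_restrict hm, hset,
    setLIntegral_congr_fun (g := fun t => ENNReal.ofReal (t ^ (q - 1))) measurableSet_Ioo
      (fun t ht => ENNReal.ofReal_rpow_of_pos ht.1),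
    setLIntegral_congr Ioo_ae_eq_Ioc, ← ofReal_integral_eq_lintegral_ofReal,
    ← intervalIntegral.integral_of_le hr, integral_rpow (Or.inl (by linarith)),
    ENNReal.ofReal_rpow_of_nonneg hr hq.le, ← ENNReal.ofReal_div_of_pos hq]
  · simp [Real.zero_rpow hq.ne']
  · exact (intervalIntegral.intervalIntegrable_rpow' (by linarith)).1
  · refine (ae_restrict_mem measurableSet_Ioc).mono fun t ht => ?_
    exact Real.rpow_nonneg ht.1.le _

/-- Layer-cake formula for the power `x ^ q` of an extended nonnegative real. -/
lemma lintegral_Ioi_indicator_rpow {q : ℝ} (hq : 0 < q) (x : ℝ≥0∞) :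
    ∫⁻ t in Ioi (0 : ℝ), {t : ℝ | ENNReal.ofReal t < x}.indicator
      (fun t => ENNReal.ofReal t ^ (q - 1)) t = x ^ q / ENNReal.ofReal q := by
  induction x with
  | coe x =>
    simpa using lintegral_Ioi_indicator_rpow_ofReal hq x.2
  | top =>
    rw [ENNReal.top_rpow_of_pos hq, ENNReal.top_div_of_ne_top ENNReal.ofReal_ne_top, eq_top_iff]
    have hlim : Filter.Tendsto (fun n : ℕ => ((n : ℝ≥0∞)) ^ q / ENNReal.ofReal q)
        Filter.atTop (nhds ⊤) := by
      have h1 := (ENNReal.continuous_rpow_const (y := q)).tendsto ⊤ |>.comp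
        ENNReal.tendsto_nat_nhds_top
      rw [ENNReal.top_rpow_of_pos hq] at h1
      have h2 := ENNReal.Tendsto.div_const (b := ENNReal.ofReal q) h1 (by simp)
      rwa [ENNReal.top_div_of_ne_top ENNReal.ofReal_ne_top] at h2
    refine le_of_tendsto' hlim fun n => ?_
    rw [← ENNReal.ofReal_natCast, ← lintegral_Ioi_indicator_rpow_ofReal hq n.cast_nonneg]
    refine lintegral_mono fun t => ?_
    exact indicator_le_indicator_of_subset (fun t _ => ENNReal.ofReal_lt_top)
      (fun _ => zero_le) t

/-- If the average of `f` over `s` exceeds `t`, then at least half of `t` comes from the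
part of `f` above level `t / 2`. -/
lemma mul_measure_le_two_mul_setLIntegral_indicator {X : Type*} [MeasurableSpace X]
    {μ : Measure X} {s : Set X} (hs : μ s ≠ ⊤) {f : X → ℝ≥0∞} (hf : Measurable f)
    {t : ℝ≥0∞} (ht : t ≠ ⊤) (h : t * μ s ≤ ∫⁻ x in s, f x ∂μ) :
    t * μ s ≤ 2 * ∫⁻ x in s, {x | t < 2 * f x}.indicator f x ∂μ := by
  have hm : MeasurableSet {x | t < 2 * f x} := measurableSet_lt measurable_const (hf.const_mul 2)
  have h1 : 2 * ∫⁻ x in s, f x ∂μ ≤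
      t * μ s + 2 * ∫⁻ x in s, {x | t < 2 * f x}.indicator f x ∂μ := by
    rw [← lintegral_const_mul _ hf, ← lintegral_const_mul _ (hf.indicator hm),
      ← setLIntegral_const, ← lintegral_add_left measurable_const]
    refine lintegral_mono fun x => ?_
    by_cases hx : t < 2 * f x
    · simp [indicator, hx]
    · simpa [indicator, hx] using not_lt.1 hx
  have h2 : t * μ s + t * μ s ≤
      t * μ s + 2 * ∫⁻ x in s, {x | t < 2 * f x}.indicator f x ∂μ := by
    rw [← two_mul]
    exact (mul_le_mul_right h 2).trans h1
  exact (ENNReal.add_le_add_iff_left (ENNReal.mul_ne_top ht hs)).1 h2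

section NestedFamily

variable {X ι : Type*} [MeasurableSpace X] {μ ω : Measure X} {Q : ι → Set X} {v : ι → ℝ≥0∞}
  {p : ℝ} {A : ℝ≥0∞} {f : X → ℝ≥0∞}

/-- The testing condition controls the maximal function of the constant `1` along a finite
family of sets over which the average of `f` exceeds `t`. -/
lemma mul_lintegral_iSup_finset_le [Countable ι]
    (hQ : ∀ i j, Disjoint (Q i) (Q j) ∨ Q i ⊆ Q j ∨ Q j ⊆ Q i)
    (hQm : ∀ i, MeasurableSet (Q i)) (hμ : ∀ i, μ (Q i) ≠ ⊤) (hp : 0 < p)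
    (htest : ∀ j, ∫⁻ x in Q j, (⨆ i, (Q i).indicator (fun _ => v i * μ (Q i ∩ Q j)) x) ^ p ∂ω
      ≤ A * μ (Q j))
    (hf : Measurable f) {t : ℝ≥0∞} (ht : t ≠ ⊤) (G : Finset ι)
    (hG : ∀ i ∈ G, t * μ (Q i) ≤ ∫⁻ x in Q i, f x ∂μ) :
    t * ∫⁻ x, (⨆ i ∈ G, (Q i).indicator (fun _ => (v i * μ (Q i)) ^ p) x) ∂ω ≤
      2 * A * ∫⁻ x, {x | t < 2 * f x}.indicator f x ∂μ := by
  obtain ⟨H, hHG, hd, hcov⟩ := exists_pairwiseDisjoint_maximal Q hQ G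
  have hpt : ∀ x, (⨆ i ∈ G, (Q i).indicator (fun _ => (v i * μ (Q i)) ^ p) x) ≤
      ∑ j ∈ H, (Q j).indicator
        (fun x => (⨆ i, (Q i).indicator (fun _ => v i * μ (Q i ∩ Q j)) x) ^ p) x := by
    intro x
    refine iSup₂_le fun i hi => ?_
    by_cases hx : x ∈ Q i
    · obtain ⟨j, hj, hij⟩ := hcov i hi
      refine le_trans ?_ (Finset.single_le_sum (fun _ _ => zero_le) hj)
      rw [indicator_of_mem hx, indicator_of_mem (hij hx)]
      refine ENNReal.rpow_le_rpow (le_iSup_of_le i ?_) hp.le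
      rw [indicator_of_mem hx, inter_eq_left.2 hij]
    · rw [indicator_of_notMem hx]
      exact zero_le
  have hsum : ∫⁻ x, (⨆ i ∈ G, (Q i).indicator (fun _ => (v i * μ (Q i)) ^ p) x) ∂ω ≤
      ∑ j ∈ H, A * μ (Q j) := by
    refine (lintegral_mono hpt).trans ?_
    rw [lintegral_finsetSum]
    · refine Finset.sum_le_sum fun j _ => ?_
      rw [lintegral_indicator (hQm j)]
      exact htest j
    · intro j _
      refine Measurable.indicator (Measurable.pow_const ?_ _) (hQm j)
      exact Measurable.iSup fun i => measurable_const.indicator (hQm i)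
  calc _ ≤ t * ∑ j ∈ H, A * μ (Q j) := mul_le_mul_right hsum t
    _ = A * ∑ j ∈ H, t * μ (Q j) := by
      simp only [Finset.mul_sum]
      exact Finset.sum_congr rfl fun _ _ => by ring
    _ ≤ A * ∑ j ∈ H, 2 * ∫⁻ x in Q j, {x | t < 2 * f x}.indicator f x ∂μ := by
      refine mul_le_mul_right (Finset.sum_le_sum fun j hj => ?_) A
      exact mul_measure_le_two_mul_setLIntegral_indicator (hμ j) hf ht (hG j (hHG hj))
    _ = 2 * A * ∫⁻ x in ⋃ j ∈ H, Q j, {x | t < 2 * f x}.indicator f x ∂μ := by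
      rw [lintegral_biUnion_finset hd (fun j _ => hQm j), ← Finset.mul_sum]
      ring
    _ ≤ _ := by
      gcongr
      exact Measure.restrict_le_self

lemma iSup_finset_rpow_le_lintegral (hμ : ∀ i, μ (Q i) ≠ ⊤) (hp : 0 < p) (F : Finset ι) (x : X) :
    (⨆ i ∈ F, (Q i).indicator (fun _ => v i * ∫⁻ y in Q i, f y ∂μ) x) ^ p ≤
      ∫⁻ t in Ioi (0 : ℝ), ENNReal.ofReal p * ENNReal.ofReal t ^ (p - 1) *
        ⨆ i ∈ F, {t : ℝ | ENNReal.ofReal t < (∫⁻ y in Q i, f y ∂μ) / μ (Q i)}.indicator 1 t *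
          (Q i).indicator (fun _ => (v i * μ (Q i)) ^ p) x := by
  rw [← ENNReal.le_rpow_inv_iff hp]
  refine iSup₂_le fun i hi => ?_
  rw [ENNReal.le_rpow_inv_iff hp]
  by_cases hx : x ∈ Q i
  · set m := (∫⁻ y in Q i, f y ∂μ) / μ (Q i) with hm
    have h0 : ∫⁻ y in Q i, f y ∂μ = μ (Q i) * m := by
      refine (ENNReal.mul_div_cancel' (fun h => ?_) (fun h => absurd h (hμ i))).symm
      rw [Measure.restrict_eq_zero.2 h, lintegral_zero_measure]
    have hmeas : Measurable ({t : ℝ | ENNReal.ofReal t < m}.indicator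
        fun t => ENNReal.ofReal t ^ (p - 1)) :=
      (ENNReal.measurable_ofReal.pow_const _).indicator
        (measurableSet_lt ENNReal.measurable_ofReal measurable_const)
    rw [indicator_of_mem hx, h0, ← mul_assoc, ENNReal.mul_rpow_of_nonneg _ _ hp.le]
    calc (v i * μ (Q i)) ^ p * m ^ p
        = (v i * μ (Q i)) ^ p * ENNReal.ofReal p * (m ^ p / ENNReal.ofReal p) := by
          rw [mul_assoc, ENNReal.mul_div_cancel (by simpa using hp) ENNReal.ofReal_ne_top]
      _ = ∫⁻ t in Ioi (0 : ℝ), (v i * μ (Q i)) ^ p * ENNReal.ofReal p *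
            {t : ℝ | ENNReal.ofReal t < m}.indicator (fun t => ENNReal.ofReal t ^ (p - 1)) t := by
          rw [lintegral_const_mul _ hmeas, lintegral_Ioi_indicator_rpow hp]
      _ ≤ _ := by
          refine lintegral_mono fun t => ?_
          refine le_trans (le_of_eq ?_) (mul_le_mul_right (le_iSup₂_of_le i hi le_rfl) _)
          rw [indicator_of_mem hx]
          by_cases ht : ENNReal.ofReal t < m
          · simp only [indicator, mem_ofPred_eq, ht, hm ▸ ht, if_true, Pi.one_apply]
            ring
          · simp [indicator, ht, hm ▸ ht]
  · rw [indicator_of_notMem hx, ENNReal.zero_rpow_of_pos hp]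
    exact zero_le

/-- The constant in the two-weight maximal inequality. -/
def sawyerConst (p : ℝ) : ℝ≥0∞ :=
  2 * ENNReal.ofReal p * (2 ^ (p - 1) / ENNReal.ofReal (p - 1))

lemma lintegral_lintegral_indicator_rpow [SFinite μ] (hp : 1 < p) (hf : Measurable f) :
    ∫⁻ t in Ioi (0 : ℝ), ENNReal.ofReal t ^ (p - 1 - 1) *
      ∫⁻ x, {x | ENNReal.ofReal t < 2 * f x}.indicator f x ∂μ =
      2 ^ (p - 1) / ENNReal.ofReal (p - 1) * ∫⁻ x, f x ^ p ∂μ := by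
  have hS : MeasurableSet {z : ℝ × X | ENNReal.ofReal z.1 < 2 * f z.2} :=
    measurableSet_lt (ENNReal.measurable_ofReal.comp measurable_fst)
      ((hf.comp measurable_snd).const_mul 2)
  have hmeas : Measurable fun z : ℝ × X => ENNReal.ofReal z.1 ^ (p - 1 - 1) *
      {x | ENNReal.ofReal z.1 < 2 * f x}.indicator f z.2 :=
    ((ENNReal.measurable_ofReal.comp measurable_fst).pow_const _).mul
      ((hf.comp measurable_snd).indicator hS)
  calc _ = ∫⁻ t in Ioi (0 : ℝ), ∫⁻ x, ENNReal.ofReal t ^ (p - 1 - 1) *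
          {x | ENNReal.ofReal t < 2 * f x}.indicator f x ∂μ := by
        refine lintegral_congr fun t => (lintegral_const_mul _ ?_).symm
        exact hf.indicator (measurableSet_lt measurable_const (hf.const_mul 2))
    _ = ∫⁻ x, (∫⁻ t in Ioi (0 : ℝ), ENNReal.ofReal t ^ (p - 1 - 1) *
          {x | ENNReal.ofReal t < 2 * f x}.indicator f x) ∂μ :=
        lintegral_lintegral_swap hmeas.aemeasurable
    _ = ∫⁻ x, f x * ((2 * f x) ^ (p - 1) / ENNReal.ofReal (p - 1)) ∂μ := by
        refine lintegral_congr fun x => ?_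
        rw [← lintegral_Ioi_indicator_rpow (by linarith : 0 < p - 1), ← lintegral_const_mul]
        · refine lintegral_congr fun t => ?_
          by_cases ht : ENNReal.ofReal t < 2 * f x
          · simp [indicator, mul_comm]
          · simp [indicator, ht]
        · exact (ENNReal.measurable_ofReal.pow_const _).indicator
            (measurableSet_lt ENNReal.measurable_ofReal measurable_const)
    _ = _ := by
        rw [← lintegral_const_mul _ (hf.pow_const p)]
        refine lintegral_congr fun x => ?_
        have h1 : f x ^ p = f x * f x ^ (p - 1) := by
          conv_lhs => rw [show p = 1 + (p - 1) by ring]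
          rw [ENNReal.rpow_add_of_nonneg _ _ zero_le_one (by linarith), ENNReal.rpow_one]
        rw [h1, ENNReal.mul_rpow_of_nonneg _ _ (by linarith), div_eq_mul_inv, div_eq_mul_inv]
        ring

lemma lintegral_iSup_finset_rpow_le [Countable ι] [SFinite μ] [SFinite ω]
    (hQ : ∀ i j, Disjoint (Q i) (Q j) ∨ Q i ⊆ Q j ∨ Q j ⊆ Q i)
    (hQm : ∀ i, MeasurableSet (Q i)) (hμ : ∀ i, μ (Q i) ≠ ⊤) (hp : 1 < p)
    (htest : ∀ j, ∫⁻ x in Q j, (⨆ i, (Q i).indicator (fun _ => v i * μ (Q i ∩ Q j)) x) ^ p ∂ω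
      ≤ A * μ (Q j))
    (hf : Measurable f) (F : Finset ι) :
    ∫⁻ x, (⨆ i ∈ F, (Q i).indicator (fun _ => v i * ∫⁻ y in Q i, f y ∂μ) x) ^ p ∂ω ≤
      sawyerConst p * A * ∫⁻ x, f x ^ p ∂μ := by
  classical
  obtain ⟨m, hm⟩ : ∃ m : ι → ℝ≥0∞, m = fun i => (∫⁻ y in Q i, f y ∂μ) / μ (Q i) := ⟨_, rfl⟩
  obtain ⟨g, hg⟩ : ∃ g : ℝ → X → ℝ≥0∞, g = fun t x => ⨆ i ∈ F,
      {t : ℝ | ENNReal.ofReal t < m i}.indicator 1 t *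
        (Q i).indicator (fun _ => (v i * μ (Q i)) ^ p) x := ⟨_, rfl⟩
  have hgm : Measurable (Function.uncurry g) := by
    rw [hg]
    refine Measurable.iSup fun i => Measurable.iSup fun _ => Measurable.mul ?_ ?_
    · exact (measurable_one.indicator (measurableSet_lt ENNReal.measurable_ofReal
        measurable_const)).comp measurable_fst
    · exact (measurable_const.indicator (hQm i)).comp measurable_snd
  have hlevel : ∀ t : ℝ, 0 < t → ENNReal.ofReal t ^ (p - 1) * ∫⁻ x, g t x ∂ω ≤
      2 * A * (ENNReal.ofReal t ^ (p - 1 - 1) *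
        ∫⁻ x, {x | ENNReal.ofReal t < 2 * f x}.indicator f x ∂μ) := by
    intro t ht
    have h1 := mul_lintegral_iSup_finset_le hQ hQm hμ (by linarith) htest hf
      (ENNReal.ofReal_ne_top (r := t)) (F.filter fun i => ENNReal.ofReal t < m i)
      fun i hi => ENNReal.mul_le_of_le_div (by simpa [hm] using (Finset.mem_filter.1 hi).2.le)
    have h2 : ∫⁻ x, g t x ∂ω ≤ ∫⁻ x, (⨆ i ∈ F.filter fun i => ENNReal.ofReal t < m i,
        (Q i).indicator (fun _ => (v i * μ (Q i)) ^ p) x) ∂ω := by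
      rw [hg]
      refine lintegral_mono fun x => iSup₂_le fun i hi => ?_
      by_cases hti : ENNReal.ofReal t < m i
      · refine le_iSup₂_of_le i (Finset.mem_filter.2 ⟨hi, hti⟩) ?_
        simp [hti]
      · simp [hti]
    have h3 : ENNReal.ofReal t ^ (p - 1) =
        ENNReal.ofReal t ^ (p - 1 - 1) * ENNReal.ofReal t := by
      conv_lhs => rw [show p - 1 = (p - 1 - 1) + 1 by ring]
      rw [ENNReal.rpow_add _ _ (by simpa using ht) ENNReal.ofReal_ne_top, ENNReal.rpow_one]
    calc _ ≤ ENNReal.ofReal t ^ (p - 1 - 1) *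
          (2 * A * ∫⁻ x, {x | ENNReal.ofReal t < 2 * f x}.indicator f x ∂μ) := by
          rw [h3, mul_assoc]
          exact mul_le_mul_right ((mul_le_mul_right h2 _).trans h1) _
      _ = _ := by ring
  have hmeas : Measurable fun z : X × ℝ =>
      ENNReal.ofReal p * ENNReal.ofReal z.2 ^ (p - 1) * g z.2 z.1 :=
    (((ENNReal.measurable_ofReal.comp measurable_snd).pow_const _).const_mul _).mul
      (hgm.comp measurable_swap)
  have hmt : Measurable fun t : ℝ => ENNReal.ofReal t ^ (p - 1 - 1) *
      ∫⁻ x, {x | ENNReal.ofReal t < 2 * f x}.indicator f x ∂μ := by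
    refine (ENNReal.measurable_ofReal.pow_const _).mul (Measurable.lintegral_prod_right' (ν := μ)
      (f := fun z : ℝ × X => {x | ENNReal.ofReal z.1 < 2 * f x}.indicator f z.2) ?_)
    exact (hf.comp measurable_snd).indicator (measurableSet_lt
      (ENNReal.measurable_ofReal.comp measurable_fst) ((hf.comp measurable_snd).const_mul 2))
  calc _ ≤ ∫⁻ x, (∫⁻ t in Ioi (0 : ℝ),
          ENNReal.ofReal p * ENNReal.ofReal t ^ (p - 1) * g t x) ∂ω := by
        subst hg hm
        exact lintegral_mono fun x => iSup_finset_rpow_le_lintegral hμ (by linarith) F x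
    _ = ∫⁻ t in Ioi (0 : ℝ), ∫⁻ x,
          ENNReal.ofReal p * ENNReal.ofReal t ^ (p - 1) * g t x ∂ω :=
        lintegral_lintegral_swap hmeas.aemeasurable
    _ ≤ ∫⁻ t in Ioi (0 : ℝ), ENNReal.ofReal p * (2 * A) * (ENNReal.ofReal t ^ (p - 1 - 1) *
          ∫⁻ x, {x | ENNReal.ofReal t < 2 * f x}.indicator f x ∂μ) := by
        refine setLIntegral_mono' measurableSet_Ioi fun t ht => ?_
        rw [lintegral_const_mul _ (show Measurable (g t) from hgm.comp measurable_prodMk_left),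
          mul_assoc, mul_assoc]
        exact mul_le_mul_right (hlevel t ht) _
    _ = _ := by
        rw [lintegral_const_mul _ hmt, lintegral_lintegral_indicator_rpow hp hf, sawyerConst]
        ring

/-- **Sawyer's theorem for a countable nested family.** The testing condition implies the
two-weight strong-type inequality for the associated maximal operator. -/
theorem lintegral_iSup_rpow_le [Countable ι] [SFinite μ] [SFinite ω]
    (hQ : ∀ i j, Disjoint (Q i) (Q j) ∨ Q i ⊆ Q j ∨ Q j ⊆ Q i)
    (hQm : ∀ i, MeasurableSet (Q i)) (hμ : ∀ i, μ (Q i) ≠ ⊤) (hp : 1 < p)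
    (htest : ∀ j, ∫⁻ x in Q j, (⨆ i, (Q i).indicator (fun _ => v i * μ (Q i ∩ Q j)) x) ^ p ∂ω
      ≤ A * μ (Q j))
    (hf : Measurable f) :
    ∫⁻ x, (⨆ i, (Q i).indicator (fun _ => v i * ∫⁻ y in Q i, f y ∂μ) x) ^ p ∂ω ≤
      sawyerConst p * A * ∫⁻ x, f x ^ p ∂μ := by
  have hp0 : 0 < p := by linarith
  set M : Finset ι → X → ℝ≥0∞ := fun F x =>
    (⨆ i ∈ F, (Q i).indicator (fun _ => v i * ∫⁻ y in Q i, f y ∂μ) x) ^ p with hM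
  have hmono : Monotone M := fun F G hFG x =>
    ENNReal.rpow_le_rpow (biSup_mono fun _ hi => hFG hi) hp0.le
  have hsup : ∀ x, (⨆ i, (Q i).indicator (fun _ => v i * ∫⁻ y in Q i, f y ∂μ) x) ^ p ≤
      ⨆ F, M F x := by
    intro x
    rw [← ENNReal.le_rpow_inv_iff hp0]
    refine iSup_le fun i => ?_
    rw [ENNReal.le_rpow_inv_iff hp0]
    exact le_iSup_of_le {i} (by simp [hM])
  refine (lintegral_mono hsup).trans ?_
  rw [lintegral_iSup_directed (fun F => ?_) hmono.directed_le]
  · exact iSup_le fun F => lintegral_iSup_finset_rpow_le hQ hQm hμ hp htest hf F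
  · refine (Measurable.pow_const ?_ _).aemeasurable
    exact Measurable.iSup fun i => Measurable.iSup fun _ => measurable_const.indicator (hQm i)

end NestedFamily

section Dyadic

variable {d : ℕ}

lemma mem_dyadicCube_iff {k : ℤ} {n : Fin d → ℤ} {x : Fin d → ℝ} :
    x ∈ dyadicCube d k n ↔ ∀ i, (n i : ℝ) ≤ x i * 2 ^ k ∧ x i * 2 ^ k < n i + 1 := by
  have h2 : (0 : ℝ) < 2 ^ k := by positivity
  simp only [dyadicCube, mem_univ_pi, mem_Ico, zpow_neg, ← div_eq_mul_inv,
    div_le_iff₀ h2, lt_div_iff₀ h2]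

lemma measurableSet_dyadicCube (k : ℤ) (n : Fin d → ℤ) : MeasurableSet (dyadicCube d k n) :=
  MeasurableSet.univ_pi fun _ => measurableSet_Ico

lemma dyadicCube_subset_of_mem {k l : ℤ} (hkl : k ≤ l) {n m : Fin d → ℤ} {x : Fin d → ℝ}
    (hn : x ∈ dyadicCube d k n) (hm : x ∈ dyadicCube d l m) :
    dyadicCube d l m ⊆ dyadicCube d k n := by
  obtain ⟨j, rfl⟩ := Int.le.dest hkl
  intro y hy
  rw [mem_dyadicCube_iff] at *
  intro i
  obtain ⟨hn1, hn2⟩ := hn i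
  obtain ⟨hm1, hm2⟩ := hm i
  obtain ⟨hy1, hy2⟩ := hy i
  have hj : (0 : ℝ) < 2 ^ j := by positivity
  rw [zpow_add₀ two_ne_zero, zpow_natCast, ← mul_assoc] at hm1 hm2 hy1 hy2
  have h1 : n i * 2 ^ j < m i + 1 := by
    have : (n i : ℝ) * 2 ^ j < m i + 1 := (mul_le_mul_of_nonneg_right hn1 hj.le).trans_lt hm2
    exact_mod_cast this
  have h2 : m i < (n i + 1) * 2 ^ j := by
    have : (m i : ℝ) < (n i + 1) * 2 ^ j := hm1.trans_lt (mul_lt_mul_of_pos_right hn2 hj)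
    exact_mod_cast this
  have h1' : (n i : ℝ) * 2 ^ j ≤ m i := by exact_mod_cast Int.lt_add_one_iff.1 h1
  have h2' : (m i : ℝ) + 1 ≤ (n i + 1) * 2 ^ j := by exact_mod_cast Int.add_one_le_iff.2 h2
  exact ⟨le_of_mul_le_mul_right (h1'.trans hy1) hj, lt_of_mul_lt_mul_right (hy2.trans_le h2') hj.le⟩

lemma dyadicCube_nested (k l : ℤ) (n m : Fin d → ℤ) :
    Disjoint (dyadicCube d k n) (dyadicCube d l m) ∨ dyadicCube d k n ⊆ dyadicCube d l m ∨
      dyadicCube d l m ⊆ dyadicCube d k n := by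
  rw [or_iff_not_imp_left, Set.not_disjoint_iff]
  rintro ⟨x, hn, hm⟩
  rcases le_total k l with h | h
  · exact Or.inr (dyadicCube_subset_of_mem h hn hm)
  · exact Or.inl (dyadicCube_subset_of_mem h hm hn)

lemma dyadicMax_eq_iSup_indicator (g : (Fin d → ℝ) → ℝ) (x : Fin d → ℝ) :
    dyadicMax d g x = ⨆ i : ℤ × (Fin d → ℤ), (dyadicCube d i.1 i.2).indicator
      (fun _ => (volume (dyadicCube d i.1 i.2))⁻¹ *
        ∫⁻ y in dyadicCube d i.1 i.2, (‖g y‖₊ : ℝ≥0∞)) x := by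
  rw [dyadicMax, iSup_prod]
  refine iSup_congr fun k => iSup_congr fun n => ?_
  by_cases hx : x ∈ dyadicCube d k n <;> simp [hx]

lemma measurable_dyadicMax (g : (Fin d → ℝ) → ℝ) : Measurable (dyadicMax d g) := by
  rw [funext (dyadicMax_eq_iSup_indicator g)]
  exact Measurable.iSup fun i => measurable_const.indicator (measurableSet_dyadicCube _ _)

/-- The measure with density `σ`. -/
def weightMeasure (σ : (Fin d → ℝ) → ℝ) : Measure (Fin d → ℝ) :=
  volume.withDensity fun x => ENNReal.ofReal (σ x)

instance (σ : (Fin d → ℝ) → ℝ) : SFinite (weightMeasure σ) := by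
  unfold weightMeasure; infer_instance

variable {σ w : (Fin d → ℝ) → ℝ}

lemma weightMeasure_dyadicCube (σ : (Fin d → ℝ) → ℝ) (k : ℤ) (n : Fin d → ℤ) :
    weightMeasure σ (dyadicCube d k n) = ∫⁻ y in dyadicCube d k n, ENNReal.ofReal (σ y) :=
  withDensity_apply _ (measurableSet_dyadicCube k n)

lemma weightMeasure_dyadicCube_ne_top (hσ : IsWeight d σ) (k : ℤ) (n : Fin d → ℤ) :
    weightMeasure σ (dyadicCube d k n) ≠ ⊤ := by
  rw [weightMeasure_dyadicCube]
  have hsub : dyadicCube d k n ⊆ Icc (fun i => (n i : ℝ) * (2:ℝ) ^ (-k))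
      fun i => ((n i : ℝ) + 1) * (2:ℝ) ^ (-k) := by
    rw [← pi_univ_Icc]
    exact pi_mono fun i _ => Ico_subset_Icc_self
  exact ((hσ.2.1.integrableOn_isCompact isCompact_Icc).mono_set hsub).lintegral_lt_top.ne

lemma setLIntegral_weightMeasure (hσ : IsWeight d σ) {f : (Fin d → ℝ) → ℝ≥0∞}
    (hf : Measurable f) {s : Set (Fin d → ℝ)} (hs : MeasurableSet s) :
    ∫⁻ x in s, f x ∂(weightMeasure σ) = ∫⁻ x in s, f x * ENNReal.ofReal (σ x) := by
  rw [weightMeasure, setLIntegral_withDensity_eq_setLIntegral_mul _ hσ.1.ennreal_ofReal hf hs]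
  simp [mul_comm]

lemma lintegral_weightMeasure (hσ : IsWeight d σ) {f : (Fin d → ℝ) → ℝ≥0∞}
    (hf : Measurable f) :
    ∫⁻ x, f x ∂(weightMeasure σ) = ∫⁻ x, f x * ENNReal.ofReal (σ x) := by
  simpa using setLIntegral_weightMeasure hσ hf MeasurableSet.univ

lemma dyadicMax_mul_eq_iSup (hσ : IsWeight d σ) {f : (Fin d → ℝ) → ℝ} (hf : Measurable f)
    (x : Fin d → ℝ) :
    dyadicMax d (fun y => σ y * f y) x =
      ⨆ i : ℤ × (Fin d → ℤ), (dyadicCube d i.1 i.2).indicator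
        (fun _ => (volume (dyadicCube d i.1 i.2))⁻¹ *
          ∫⁻ y in dyadicCube d i.1 i.2, (‖f y‖₊ : ℝ≥0∞) ∂(weightMeasure σ)) x := by
  rw [dyadicMax_eq_iSup_indicator]
  have h : ∀ i : ℤ × (Fin d → ℤ), ∫⁻ y in dyadicCube d i.1 i.2, (‖σ y * f y‖₊ : ℝ≥0∞) =
      ∫⁻ y in dyadicCube d i.1 i.2, (‖f y‖₊ : ℝ≥0∞) ∂(weightMeasure σ) := by
    intro i
    rw [setLIntegral_weightMeasure hσ hf.nnnorm.coe_nnreal_ennreal (measurableSet_dyadicCube _ _)]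
    refine lintegral_congr_ae (ae_restrict_of_ae (hσ.2.2.mono fun y hy => ?_))
    simp only [nnnorm_mul, ENNReal.coe_mul]
    rw [mul_comm, ← enorm_eq_nnnorm (σ y), Real.enorm_of_nonneg hy.le]
  simp only [h]

lemma dyadicCube_indicator_eq_mul (σ : (Fin d → ℝ) → ℝ) (k : ℤ) (n : Fin d → ℤ) :
    (dyadicCube d k n).indicator σ = fun y => σ y * (dyadicCube d k n).indicator 1 y := by
  ext y
  by_cases hy : y ∈ dyadicCube d k n <;> simp [hy]

lemma dyadicMax_indicator_eq_iSup (hσ : IsWeight d σ) (k : ℤ) (n : Fin d → ℤ) (x : Fin d → ℝ) :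
    dyadicMax d ((dyadicCube d k n).indicator σ) x =
      ⨆ i : ℤ × (Fin d → ℤ), (dyadicCube d i.1 i.2).indicator
        (fun _ => (volume (dyadicCube d i.1 i.2))⁻¹ *
          weightMeasure σ (dyadicCube d i.1 i.2 ∩ dyadicCube d k n)) x := by
  rw [dyadicCube_indicator_eq_mul, dyadicMax_mul_eq_iSup hσ
    (measurable_one.indicator (measurableSet_dyadicCube k n))]
  have h : ∀ y, (‖(dyadicCube d k n).indicator (1 : (Fin d → ℝ) → ℝ) y‖₊ : ℝ≥0∞) =
      (dyadicCube d k n).indicator 1 y := by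
    intro y
    by_cases hy : y ∈ dyadicCube d k n <;> simp [hy]
  simp only [h, lintegral_indicator_one (measurableSet_dyadicCube k n),
    Measure.restrict_apply (measurableSet_dyadicCube k n), inter_comm]

lemma sawyerTestConst_le_sawyerNormConst {p : ℝ} (hp : 1 < p) (w σ : (Fin d → ℝ) → ℝ) :
    sawyerTestConst d p w σ ≤ sawyerNormConst d p w σ := by
  have hp0 : 0 < p := by linarith
  refine le_sInf fun c hc => sInf_le fun k n => ?_
  have h := ENNReal.rpow_le_rpow (hc ((dyadicCube d k n).indicator 1)
    (measurable_one.indicator (measurableSet_dyadicCube k n))) hp0.le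
  rw [ENNReal.mul_rpow_of_nonneg _ _ hp0.le, ← ENNReal.rpow_mul, ← ENNReal.rpow_mul,
    one_div_mul_cancel hp0.ne', ENNReal.rpow_one, ENNReal.rpow_one,
    ← dyadicCube_indicator_eq_mul] at h
  refine (setLIntegral_le_lintegral _ _).trans (h.trans (le_of_eq ?_))
  rw [← lintegral_indicator (measurableSet_dyadicCube k n)]
  congr 1
  refine lintegral_congr fun y => ?_
  by_cases hy : y ∈ dyadicCube d k n <;> simp [hy, hp0]

lemma lintegral_dyadicMax_rpow_le {p : ℝ} (hp : 1 < p) (hw : IsWeight d w) (hσ : IsWeight d σ)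
    {A : ℝ≥0∞}
    (htest : ∀ (k : ℤ) (n : Fin d → ℤ), ∫⁻ x in dyadicCube d k n,
        (dyadicMax d ((dyadicCube d k n).indicator σ) x) ^ p * ENNReal.ofReal (w x) ≤
      A * ∫⁻ y in dyadicCube d k n, ENNReal.ofReal (σ y))
    {f : (Fin d → ℝ) → ℝ} (hf : Measurable f) :
    ∫⁻ x, (dyadicMax d (fun y => σ y * f y) x) ^ p * ENNReal.ofReal (w x) ≤
      sawyerConst p * A * ∫⁻ x, (‖f x‖₊ : ℝ≥0∞) ^ p * ENNReal.ofReal (σ x) := by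
  have hfm := hf.nnnorm.coe_nnreal_ennreal
  rw [← lintegral_weightMeasure hw ((measurable_dyadicMax _).pow_const p),
    ← lintegral_weightMeasure hσ (hfm.pow_const p)]
  simp only [dyadicMax_mul_eq_iSup hσ hf]
  refine lintegral_iSup_rpow_le (Q := fun i : ℤ × (Fin d → ℤ) => dyadicCube d i.1 i.2)
    (v := fun i => (volume (dyadicCube d i.1 i.2))⁻¹)
    (fun i j => dyadicCube_nested _ _ _ _) (fun i => measurableSet_dyadicCube _ _)
    (fun i => weightMeasure_dyadicCube_ne_top hσ _ _) hp (fun j => ?_) hfm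
  have h := htest j.1 j.2
  rw [← setLIntegral_weightMeasure hw ((measurable_dyadicMax _).pow_const p)
    (measurableSet_dyadicCube _ _), ← weightMeasure_dyadicCube] at h
  simpa only [dyadicMax_indicator_eq_iSup hσ] using h

lemma sawyerConst_pos {p : ℝ} (hp : 1 < p) : 0 < sawyerConst p := by
  refine ENNReal.mul_pos (by simpa using hp.trans' one_pos) ?_
  simp

lemma sawyerConst_ne_top {p : ℝ} (hp : 1 < p) : sawyerConst p ≠ ⊤ := by
  refine ENNReal.mul_ne_top (ENNReal.mul_ne_top (by simp) (by simp)) ?_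
  exact ENNReal.div_ne_top (ENNReal.rpow_ne_top_of_nonneg (by linarith) (by simp)) (by simpa)

lemma sawyerNormConst_le {p : ℝ} (hp : 1 < p) (hw : IsWeight d w) (hσ : IsWeight d σ) :
    sawyerNormConst d p w σ ≤ sawyerConst p ^ (1 / p) * sawyerTestConst d p w σ := by
  have hp0 : 0 < p := by linarith
  have hK0 : sawyerConst p ^ (1 / p) ≠ 0 := by
    simp [ENNReal.rpow_eq_zero_iff, (sawyerConst_pos hp).ne', sawyerConst_ne_top hp]
  have hKt : sawyerConst p ^ (1 / p) ≠ ⊤ :=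
    ENNReal.rpow_ne_top_of_nonneg (by positivity) (sawyerConst_ne_top hp)
  rw [mul_comm, ← ENNReal.div_le_iff hK0 hKt]
  refine le_sInf fun c hc => ?_
  rw [ENNReal.div_le_iff hK0 hKt]
  refine sInf_le fun f hf => ?_
  have h := ENNReal.rpow_le_rpow (lintegral_dyadicMax_rpow_le hp hw hσ hc hf)
    (one_div_pos.2 hp0).le
  refine h.trans (le_of_eq ?_)
  rw [ENNReal.mul_rpow_of_nonneg _ _ (by positivity), ENNReal.mul_rpow_of_nonneg _ _ (by positivity),
    ← ENNReal.rpow_mul, mul_one_div_cancel hp0.ne', ENNReal.rpow_one, mul_comm c]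

end Dyadic

/-- **Sawyer's two-weight theorem for the dyadic maximal function.** For `1 < p < ∞` there are
constants `0 < c, C` depending only on `p` and `d` such that for every pair of weights
`(w, σ)` on `ℝ^d`, the least constant `C₁` in `‖M_𝒟(σf)‖_{L^p(w)} ≤ C₁‖f‖_{L^p(σ)}` and the
least testing constant `C₂` are comparable: `c·C₂ ≤ C₁ ≤ C·C₂`.  In particular, the
two-weight norm inequality holds if and only if the testing condition holds. -/
theorem sawyer_two_weight_maximal (d : ℕ) (p : ℝ) (hp : 1 < p) :
    ∃ c C : ℝ, 0 < c ∧ 0 < C ∧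
      ∀ w σ : (Fin d → ℝ) → ℝ, IsWeight d w → IsWeight d σ →
        (ENNReal.ofReal c * sawyerTestConst d p w σ ≤ sawyerNormConst d p w σ ∧
         sawyerNormConst d p w σ ≤ ENNReal.ofReal C * sawyerTestConst d p w σ) ∧
        (sawyerNormConst d p w σ < ⊤ ↔ sawyerTestConst d p w σ < ⊤) := by
  have hKt : sawyerConst p ^ (1 / p) ≠ ⊤ :=
    ENNReal.rpow_ne_top_of_nonneg (by positivity) (sawyerConst_ne_top hp)
  refine ⟨1, (sawyerConst p ^ (1 / p)).toReal, one_pos,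
    ENNReal.toReal_pos ?_ hKt, fun w σ hw hσ => ?_⟩
  · simp [ENNReal.rpow_eq_zero_iff, (sawyerConst_pos hp).ne', sawyerConst_ne_top hp]
  have hle := sawyerTestConst_le_sawyerNormConst hp w σ
  have hge := sawyerNormConst_le hp hw hσ
  rw [ENNReal.ofReal_one, one_mul, ENNReal.ofReal_toReal hKt]
  exact ⟨⟨hle, hge⟩, hle.trans_lt, fun h => hge.trans_lt (ENNReal.mul_lt_top hKt.lt_top h)⟩
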